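/- The unique maximizer of H over the hyperplane {p ∈ ℝ^N : b·p = β₀} is p* = −(1/γ)·Σ_{i=1}^k γ_i ρ_i + [β₀ + (1/γ)·Σ_{i=1}^k γ_i (ρ_i·b)] · C⁻¹b / (b·(C⁻¹b)). (This is the formula obtained at the end of the proof of Theorem 3 of the paper, for the optimal beta-constrained portfolio in the CAPM when direct investment in the benchmark is not allowed.) -/

import Mathlib

open Matrix

/-- The deterministic objective function `H = F + G/2` from the proof of Theorem 1 of
"Optimal Portfolio with Power Utility of Absolute and Relative Wealth". -/
noncomputable def Hfun {ι : Type} [Fintype ι] {k : ℕ} (A : Matrix ι ι ℝ) (g : ι → ℝ)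
    (r γ : ℝ) (γ' : Fin k → ℝ) (ρ : Fin k → ι → ℝ) (p : ι → ℝ) : ℝ :=
  ((1 - γ) * (p ⬝ᵥ g + (1 - (fun _ => (1 : ℝ)) ⬝ᵥ p) * r - A.mulVec p ⬝ᵥ p / 2)
      - ∑ j, γ' j * (ρ j ⬝ᵥ g + (1 - (fun _ => (1 : ℝ)) ⬝ᵥ ρ j) * r
          - A.mulVec (ρ j) ⬝ᵥ ρ j / 2))
    + (A.mulVec ((1 - γ) • p - ∑ j, γ' j • ρ j) ⬝ᵥ ((1 - γ) • p - ∑ j, γ' j • ρ j)) / 2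


/-- Second-order expansion of `Hfun` around `q` in the direction `d`. -/
theorem Hfun_add {ι : Type} [Fintype ι] {k : ℕ} {A : Matrix ι ι ℝ} (hA : Aᵀ = A) (g : ι → ℝ)
    (r γ : ℝ) (γ' : Fin k → ℝ) (ρ : Fin k → ι → ℝ) (q d : ι → ℝ) :
    Hfun A g r γ γ' ρ (q + d) = Hfun A g r γ γ' ρ q
      + (1 - γ) * (d ⬝ᵥ (g - r • fun _ => (1 : ℝ)) - d ⬝ᵥ A *ᵥ (γ • q + ∑ j, γ' j • ρ j))
      - γ * (1 - γ) / 2 * (d ⬝ᵥ A *ᵥ d) := by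
  have hsymm (x y : ι → ℝ) : x ⬝ᵥ A *ᵥ y = y ⬝ᵥ A *ᵥ x := by
    rw [dotProduct_mulVec, ← mulVec_transpose, hA, dotProduct_comm]
  unfold Hfun
  generalize ∑ j, γ' j • ρ j = S
  simp only [dotProduct_comm (A *ᵥ _), dotProduct_comm (fun _ : ι => (1 : ℝ)), mulVec_add,
    mulVec_sub, mulVec_smul, dotProduct_add, add_dotProduct, dotProduct_sub, sub_dotProduct,
    dotProduct_smul, smul_dotProduct, smul_eq_mul, smul_add]
  rw [hsymm q d, hsymm S d, hsymm S q]
  ring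

/-- end of the proof of Theorem 3 of the paper: in the CAPM without direct
investment in the benchmark (`A = C + σ²bbᵀ`, `g = (μ−r)b + r𝟏`), the unique maximizer of `H`
over the hyperplane `{p : b·p = β₀}` is
`p* = −(1/γ)Σᵢ γᵢρᵢ + [β₀ + (1/γ)Σᵢ γᵢ(ρᵢ·b)]·C⁻¹b/(b·C⁻¹b)`. -/
theorem capm_no_benchmark_optimum (N k : ℕ) (hN : 1 ≤ N)
    (C : Matrix (Fin N) (Fin N) ℝ) (hC : C.PosDef) (b : Fin N → ℝ) (hb : b ≠ 0)
    (σ μ r β₀ : ℝ) (hσ : 0 < σ) (γ : ℝ) (hγ : γ ∈ Set.Ioo (0 : ℝ) 1)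
    (γ' : Fin k → ℝ) (ρ : Fin k → Fin N → ℝ) :
    let A : Matrix (Fin N) (Fin N) ℝ := C + σ ^ 2 • Matrix.vecMulVec b b
    let g : Fin N → ℝ := (μ - r) • b + r • (fun _ => (1 : ℝ))
    let pstar : Fin N → ℝ :=
      -(γ⁻¹ • ∑ i, γ' i • ρ i)
        + ((β₀ + γ⁻¹ * ∑ i, γ' i * (ρ i ⬝ᵥ b)) / (b ⬝ᵥ C⁻¹.mulVec b)) • C⁻¹.mulVec b
    b ⬝ᵥ pstar = β₀
      ∧ ∀ p : Fin N → ℝ, b ⬝ᵥ p = β₀ → p ≠ pstar →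
          Hfun A g r γ γ' ρ p < Hfun A g r γ γ' ρ pstar := by
  intro A g pstar
  obtain ⟨hγ0, hγ1⟩ := hγ
  have hB : 0 < b ⬝ᵥ C⁻¹ *ᵥ b := by simpa using hC.inv.dotProduct_mulVec_pos hb
  have hCb : C *ᵥ C⁻¹ *ᵥ b = b := by
    rw [mulVec_mulVec, mul_nonsing_inv _ ((isUnit_iff_isUnit_det C).mp hC.isUnit), one_mulVec]
  have hCT : Cᵀ = C := by simpa using hC.isHermitian.eq
  have hAT : Aᵀ = A := by
    simp [A, transpose_add, transpose_smul, transpose_vecMulVec, hCT]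
  have hA (x : Fin N → ℝ) : A *ᵥ x = C *ᵥ x + (σ ^ 2 * (b ⬝ᵥ x)) • b := by
    simp [A, add_mulVec, smul_mulVec, vecMulVec_mulVec, smul_smul]
  have hbp : b ⬝ᵥ pstar = β₀ := by
    simp only [pstar, dotProduct_add, dotProduct_neg, dotProduct_smul, dotProduct_sum,
      smul_eq_mul, dotProduct_comm b (ρ _), div_mul_cancel₀ _ hB.ne']
    ring
  refine ⟨hbp, fun p hp hne => ?_⟩
  obtain ⟨d, rfl⟩ : ∃ d, p = pstar + d := ⟨p - pstar, by simp⟩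
  have hd : d ≠ 0 := by rintro rfl; simp at hne
  have hdb : d ⬝ᵥ b = 0 := by
    rw [dotProduct_add, hbp] at hp
    rw [dotProduct_comm]
    linarith
  have hgrad : d ⬝ᵥ A *ᵥ (γ • pstar + ∑ j, γ' j • ρ j) = 0 := by
    have hfoc : γ • pstar + ∑ j, γ' j • ρ j
        = (γ * ((β₀ + γ⁻¹ * ∑ i, γ' i * (ρ i ⬝ᵥ b)) / (b ⬝ᵥ C⁻¹ *ᵥ b))) • C⁻¹ *ᵥ b := by
      simp only [pstar, smul_add, smul_neg, smul_smul, mul_inv_cancel₀ hγ0.ne', one_smul]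
      abel
    rw [hfoc, hA, mulVec_smul, hCb]
    simp [dotProduct_add, hdb]
  have hlin : d ⬝ᵥ (g - r • fun _ => (1 : ℝ)) = 0 := by simp [g, hdb]
  have hquad : 0 < d ⬝ᵥ A *ᵥ d := by
    rw [hA, dotProduct_add, dotProduct_smul, hdb]
    simpa using hC.dotProduct_mulVec_pos hd
  rw [Hfun_add hAT, hlin, hgrad]
  have := mul_pos (mul_pos hγ0 (sub_pos.mpr hγ1)) hquad
  linarith
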